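/- For every positive integer k, the numerical semigroup generated by S = {12k+8, 18k+13, 18k+15} is a 3-permutation numerical semigroup. -/

import Mathlib

/-- The increasing enumeration of the positive elements of a submonoid `G` of `ℕ`
(0-indexed: `posSeq G 0` is the smallest positive element `g₁` of `G`). -/
noncomputable def posSeq (G : AddSubmonoid ℕ) : ℕ → ℕ :=
  Nat.nth (fun x => x ∈ G ∧ 0 < x)

/-- `G` is an `n`-permutation numerical semigroup: `G` is a cofinite submonoid of `ℕ`,
it is generated by its `n` smallest positive elements `g₁ < ⋯ < gₙ`, and for every
`k ≥ 0` the tuple `(g_{kn+1} mod n, …, g_{kn+n} mod n)` contains exactly one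
representative of each residue class of `ℤ/nℤ`. -/
def IsPermutationSemigroup (n : ℕ) (G : AddSubmonoid ℕ) : Prop :=
  ((G : Set ℕ)ᶜ).Finite ∧
  G = AddSubmonoid.closure (posSeq G '' Set.Iio n) ∧
  ∀ k : ℕ, Function.Bijective (fun j : Fin n => ((posSeq G (k * n + j.val) : ℕ) : ZMod n))

/-- Membership criterion for `w * (6k+4) + t` with `t < 6k+4`. -/
def Crit (k w t : ℕ) : Prop :=
  (w % 2 = 0 ∧ t % 2 = 0 ∧ t ≤ 6 * (w / 6)) ∨
  (w % 2 = 1 ∧ t % 2 = 1 ∧ t + 3 ≤ 6 * ((w + 3) / 6)) ∨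
  (w % 2 = 1 ∧ t % 2 = 0 ∧ t + 6 * k + 4 ≤ 6 * ((w - 1) / 6)) ∨
  (w % 2 = 0 ∧ t % 2 = 1 ∧ t + 6 * k + 7 ≤ 6 * ((w + 2) / 6))

/-- Starts of triples below the conductor. -/
def StC (k w t : ℕ) : Prop :=
  2 ≤ w ∧ w ≤ 12 * k + 9 ∧ t < 6 * k + 4 ∧
  ((w % 2 = 0 ∧ t % 6 = 0 ∧ t ≤ 6 * (w / 6)) ∨
   (w % 2 = 0 ∧ t % 6 = 3 ∧ t + 6 * k + 7 ≤ 6 * ((w + 2) / 6)) ∨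
   (w % 2 = 1 ∧ t % 6 = 5 ∧ t + 3 ≤ 6 * ((w + 3) / 6) ∧ 6 * ((w - 1) / 6) < t + 6 * k + 4) ∨
   (w % 2 = 1 ∧ t % 6 = 4 ∧ t + 6 * k + 4 ≤ 6 * ((w - 1) / 6)) ∨
   (w % 2 = 1 ∧ t % 6 = 1 ∧ t + 6 * k + 5 ≤ 6 * ((w - 1) / 6)))

def St (k x : ℕ) : Prop :=
  (∃ w t, x = w * (6 * k + 4) + t ∧ StC k w t) ∨
  ((12 * k + 10) * (6 * k + 4) ≤ x ∧ x % 3 = 1)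

abbrev GG (k : ℕ) : AddSubmonoid ℕ :=
  AddSubmonoid.closure ({12 * k + 8, 18 * k + 13, 18 * k + 15} : Set ℕ)

lemma mem_GG (k g : ℕ) : g ∈ GG k ↔
    ∃ x y z : ℕ, g = x * (12 * k + 8) + y * (18 * k + 13) + z * (18 * k + 15) := by
  constructor
  · intro h
    induction h using AddSubmonoid.closure_induction with
    | mem x hx =>
      rcases hx with rfl | rfl | rfl
      · exact ⟨1, 0, 0, by ring⟩
      · exact ⟨0, 1, 0, by ring⟩
      · exact ⟨0, 0, 1, by ring⟩
    | zero => exact ⟨0, 0, 0, by ring⟩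
    | add a b _ _ ha hb =>
      obtain ⟨x, y, z, rfl⟩ := ha
      obtain ⟨x', y', z', rfl⟩ := hb
      exact ⟨x + x', y + y', z + z', by ring⟩
  · rintro ⟨x, y, z, rfl⟩
    have h1 : 12 * k + 8 ∈ GG k := AddSubmonoid.subset_closure (by simp)
    have h2 : 18 * k + 13 ∈ GG k := AddSubmonoid.subset_closure (by simp)
    have h3 : 18 * k + 15 ∈ GG k := AddSubmonoid.subset_closure (by simp)
    have := add_mem (add_mem (nsmul_mem h1 x) (nsmul_mem h2 y)) (nsmul_mem h3 z)
    simpa using this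

lemma mem_of_rep (k W T s : ℕ) (h1 : s ≤ T) (h2 : T ≤ 3 * s) (h3 : s % 2 = T % 2)
    (h4 : s % 2 = W % 2) (h5 : 3 * s ≤ W) : W * (6 * k + 4) + T ∈ GG k := by
  rw [mem_GG]
  obtain ⟨z, hz⟩ : ∃ z, T = s + 2 * z := ⟨(T - s) / 2, by omega⟩
  obtain ⟨y, hy⟩ : ∃ y, s = y + z := ⟨s - z, by omega⟩
  obtain ⟨x, hx⟩ : ∃ x, W = 3 * s + 2 * x := ⟨(W - 3 * s) / 2, by omega⟩
  refine ⟨x, y, z, ?_⟩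
  subst hx; subst hz; subst hy
  ring

lemma mem_of_rep' (k W T : ℕ)
    (h : (W % 2 = 0 ∧ T % 2 = 0 ∧ T ≤ 6 * (W / 6)) ∨
      (W % 2 = 1 ∧ T % 2 = 1 ∧ T + 3 ≤ 6 * ((W + 3) / 6))) :
    W * (6 * k + 4) + T ∈ GG k := by
  rcases h with h | h
  · exact mem_of_rep k W T (2 * ((T + 5) / 6)) (by omega) (by omega) (by omega) (by omega) (by omega)
  · exact mem_of_rep k W T (2 * ((T + 2) / 6) + 1) (by omega) (by omega) (by omega) (by omega)
      (by omega)

lemma mem_iff (k w t : ℕ) (ht : t < 6 * k + 4) : w * (6 * k + 4) + t ∈ GG k ↔ Crit k w t := by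
  constructor
  · rw [mem_GG]
    rintro ⟨x, y, z, h⟩
    obtain ⟨W, hW⟩ : ∃ W, W = 2 * x + 3 * y + 3 * z := ⟨_, rfl⟩
    have h' : w * (6 * k + 4) + t = W * (6 * k + 4) + (y + 3 * z) := by
      rw [h, hW]; ring
    have hM : (W % 2 = 0 ∧ (y + 3 * z) % 2 = 0 ∧ y + 3 * z ≤ 6 * (W / 6)) ∨
        (W % 2 = 1 ∧ (y + 3 * z) % 2 = 1 ∧ y + 3 * z + 3 ≤ 6 * ((W + 3) / 6)) := by
      clear h h'
      rcases Nat.even_or_odd' (y + z) with ⟨s, hs | hs⟩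
      · left
        have : s ≤ W / 6 := by omega
        omega
      · right
        have : s + 1 ≤ (W + 3) / 6 := by omega
        omega
    have hWw : W ≤ w := by
      by_contra hc
      have : (w + 1) * (6 * k + 4) ≤ W * (6 * k + 4) := Nat.mul_le_mul_right _ (by omega)
      rw [add_mul] at this
      omega
    obtain ⟨d, rfl⟩ := Nat.exists_eq_add_of_le hWw
    rw [add_mul] at h'
    unfold Crit
    rcases Nat.lt_or_ge d 2 with hd | hd
    · clear h
      obtain rfl | rfl : d = 0 ∨ d = 1 := by omega
      · rw [zero_mul] at h'
        rw [add_zero]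
        omega
      · rw [one_mul] at h'
        omega
    · obtain ⟨e, rfl⟩ := Nat.exists_eq_add_of_le hd
      rw [add_mul] at h'
      omega
  · rintro (h | h | h | h)
    · exact mem_of_rep' k w t (by omega)
    · exact mem_of_rep' k w t (by omega)
    · obtain ⟨v, rfl⟩ : ∃ v, w = v + 1 := ⟨w - 1, by omega⟩
      have := mem_of_rep' k v (t + (6 * k + 4)) (by omega)
      convert this using 1; ring
    · obtain ⟨v, rfl⟩ : ∃ v, w = v + 1 := ⟨w - 1, by omega⟩
      have := mem_of_rep' k v (t + (6 * k + 4)) (by omega)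
      convert this using 1; ring

lemma mem_large (k g : ℕ) (hg : (12 * k + 9) * (6 * k + 4) ≤ g) : g ∈ GG k := by
  have h := Nat.div_add_mod' g (6 * k + 4)
  have h2 := Nat.mod_lt g (show 6 * k + 4 > 0 by omega)
  rw [← h, mem_iff _ _ _ h2]
  have h3 : 12 * k + 9 ≤ g / (6 * k + 4) := (Nat.le_div_iff_mul_le (by omega)).2 hg
  unfold Crit
  omega

/-- Criterion for step. -/
def Step (k x : ℕ) : Prop :=
  ∃ y z x', x < y ∧ y < z ∧ z < x' ∧ y ∈ GG k ∧ z ∈ GG k ∧ x' ∈ GG k ∧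
    (∀ g ∈ GG k, g ≤ x ∨ g = y ∨ g = z ∨ x' ≤ g) ∧
    x % 3 ≠ y % 3 ∧ x % 3 ≠ z % 3 ∧ y % 3 ≠ z % 3 ∧ St k x'

lemma St_mem (k x : ℕ) (h : St k x) : x ∈ GG k := by
  rcases h with ⟨w, t, rfl, h⟩ | ⟨h, _⟩
  · have h' := h
    unfold StC at h'
    rw [mem_iff k w t (by omega)]
    unfold Crit
    omega
  · apply mem_large
    refine le_trans ?_ h
    exact Nat.mul_le_mul_right _ (by omega)

lemma mk_step (k w t p q r : ℕ) (hr : r ≤ 2 * (6 * k + 4))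
    (htp : t < p) (hpq : p < q) (hqr : q < r)
    (hp : (p < 6 * k + 4 ∧ Crit k w p) ∨ (6 * k + 4 ≤ p ∧ p < 2 * (6 * k + 4) ∧ Crit k (w + 1) (p - (6 * k + 4))))
    (hq : (q < 6 * k + 4 ∧ Crit k w q) ∨ (6 * k + 4 ≤ q ∧ q < 2 * (6 * k + 4) ∧ Crit k (w + 1) (q - (6 * k + 4))))
    (hg : ∀ u, t < u → u < r → u ≠ p → u ≠ q → u < 6 * k + 4 → ¬ Crit k w u)
    (hg' : ∀ u, t < u + (6 * k + 4) → u + (6 * k + 4) < r → u + (6 * k + 4) ≠ p →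
      u + (6 * k + 4) ≠ q → ¬ Crit k (w + 1) u)
    (h3 : t % 3 ≠ p % 3 ∧ t % 3 ≠ q % 3 ∧ p % 3 ≠ q % 3)
    (hs : St k (w * (6 * k + 4) + r)) : Step k (w * (6 * k + 4) + t) := by
  have key : ∀ p, (p < 6 * k + 4 ∧ Crit k w p) ∨ (6 * k + 4 ≤ p ∧ p < 2 * (6 * k + 4) ∧ Crit k (w + 1) (p - (6 * k + 4))) →
      w * (6 * k + 4) + p ∈ GG k := by
    rintro p (⟨h1, h2⟩ | ⟨h0, h1, h2⟩)
    · exact (mem_iff k w p h1).2 h2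
    · have := (mem_iff k (w + 1) (p - (6 * k + 4)) (by omega)).2 h2
      rw [add_mul] at this
      convert this using 1
      omega
  refine ⟨w * (6 * k + 4) + p, w * (6 * k + 4) + q, w * (6 * k + 4) + r, by omega, by omega,
    by omega, key p hp, key q hq, St_mem _ _ hs, ?_, by omega, by omega, by omega, hs⟩
  intro g hgm
  by_contra hc
  obtain ⟨u, rfl⟩ : ∃ u, g = w * (6 * k + 4) + u := ⟨g - w * (6 * k + 4), by omega⟩
  by_cases hu : u < 6 * k + 4
  · exact hg u (by omega) (by omega) (by omega) (by omega) hu ((mem_iff k w u hu).1 hgm)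
  · obtain ⟨v, rfl⟩ : ∃ v, u = v + (6 * k + 4) := ⟨u - (6 * k + 4), by omega⟩
    refine hg' v (by omega) (by omega) (by omega) (by omega) ((mem_iff k (w + 1) v (by omega)).1 ?_)
    convert hgm using 1
    ring

lemma St_of0 (k w r : ℕ) (h : StC k w r) : St k (w * (6 * k + 4) + r) := Or.inl ⟨w, r, rfl, h⟩

lemma St_of1 (k w r v : ℕ) (hr : r = v + (6 * k + 4)) (h : StC k (w + 1) v) :
    St k (w * (6 * k + 4) + r) := Or.inl ⟨w + 1, v, by subst hr; ring, h⟩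

lemma St_of2 (k w r v : ℕ) (hr : r = v + 2 * (6 * k + 4)) (h : StC k (w + 2) v) :
    St k (w * (6 * k + 4) + r) := Or.inl ⟨w + 2, v, by subst hr; ring, h⟩

lemma St_last (k : ℕ) : St k ((12 * k + 9) * (6 * k + 4) + (6 * k + 4)) := by
  right
  have : (12 * k + 9) * (6 * k + 4) + (6 * k + 4) = 3 * (24 * k ^ 2 + 36 * k + 13) + 1 := by ring
  constructor
  · apply le_of_eq; ring
  · omega

lemma St_next1 (k w r : ℕ) (hr : r = 6 * k + 4) (hw : 1 ≤ w) (hw2 : w ≤ 12 * k + 9)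
    (ho : w % 2 = 1) :
    St k (w * (6 * k + 4) + r) := by
  subst hr
  rcases Nat.lt_or_ge w (12 * k + 9) with h | h
  · exact St_of1 k w _ 0 (by omega) (by unfold StC; omega)
  · obtain rfl : w = 12 * k + 9 := by omega
    exact St_last k

set_option maxHeartbeats 4000000 in
lemma step_low (k : ℕ) (hk : 0 < k) (w t : ℕ) (h : StC k w t) :
    Step k (w * (6 * k + 4) + t) := by
  obtain ⟨hw2, hw, ht, h | h | h | h | h⟩ := h
  · by_cases c1 : t + 6 * k + 8 ≤ 6 * ((w + 2) / 6)
    · refine mk_step k w t (t + 1) (t + 2) (t + 3) ?_ ?_ ?_ ?_ ?_ ?_ ?_ ?_ ?_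
        (St_of0 _ _ _ ?_) <;> (try unfold Crit) <;> (try unfold StC) <;> omega
    by_cases c2 : t + 6 ≤ 6 * (w / 6)
    · by_cases c3 : t = 6 * k
      · refine mk_step k w t (t + 2) (t + 4) (t + 5) ?_ ?_ ?_ ?_ ?_ ?_ ?_ ?_ ?_
          (St_of1 _ _ _ 1 ?_ ?_) <;> (try unfold Crit) <;> (try unfold StC) <;> omega
      · refine mk_step k w t (t + 2) (t + 4) (t + 6) ?_ ?_ ?_ ?_ ?_ ?_ ?_ ?_ ?_
          (St_of0 _ _ _ ?_) <;> (try unfold Crit) <;> (try unfold StC) <;> omega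
    · by_cases c3 : 8 ≤ w
      · refine mk_step k w t (6 * k + 5) (6 * k + 7) (6 * k + 9) ?_ ?_ ?_ ?_ ?_ ?_ ?_ ?_ ?_
          (St_of1 _ _ _ 5 ?_ ?_) <;> (try unfold Crit) <;> (try unfold StC) <;> omega
      · refine mk_step k w t (6 * k + 5) (6 * k + 7) (2 * (6 * k + 4)) ?_ ?_ ?_ ?_ ?_ ?_ ?_ ?_ ?_
          (St_of2 _ _ _ 0 ?_ ?_) <;> (try unfold Crit) <;> (try unfold StC) <;> omega
  · refine mk_step k w t (t + 1) (t + 2) (t + 3) ?_ ?_ ?_ ?_ ?_ ?_ ?_ ?_ ?_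
      (St_of0 _ _ _ ?_) <;> (try unfold Crit) <;> (try unfold StC) <;> omega
  · by_cases c1 : t + 9 ≤ 6 * ((w + 3) / 6) ∧ t + 6 < 6 * k + 4
    · refine mk_step k w t (t + 2) (t + 4) (t + 6) ?_ ?_ ?_ ?_ ?_ ?_ ?_ ?_ ?_
        (St_of0 _ _ _ ?_) <;> (try unfold Crit) <;> (try unfold StC) <;> omega
    · refine mk_step k w t (t + 2) (t + 4) (6 * k + 4) ?_ ?_ ?_ ?_ ?_ ?_ ?_ ?_ ?_
        (St_next1 _ _ _ ?_ ?_ ?_ ?_) <;> (try unfold Crit) <;> (try unfold StC) <;> omega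
  · refine mk_step k w t (t + 1) (t + 2) (t + 3) ?_ ?_ ?_ ?_ ?_ ?_ ?_ ?_ ?_
      (St_of0 _ _ _ ?_) <;> (try unfold Crit) <;> (try unfold StC) <;> omega
  · by_cases c1 : t = 6 * k + 1
    · refine mk_step k w t (t + 1) (t + 2) (6 * k + 4) ?_ ?_ ?_ ?_ ?_ ?_ ?_ ?_ ?_
        (St_next1 _ _ _ ?_ ?_ ?_ ?_) <;> (try unfold Crit) <;> (try unfold StC) <;> omega
    by_cases c2 : t + 6 * k + 7 ≤ 6 * ((w - 1) / 6)
    · refine mk_step k w t (t + 1) (t + 2) (t + 3) ?_ ?_ ?_ ?_ ?_ ?_ ?_ ?_ ?_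
        (St_of0 _ _ _ ?_) <;> (try unfold Crit) <;> (try unfold StC) <;> omega
    · refine mk_step k w t (t + 1) (t + 2) (t + 4) ?_ ?_ ?_ ?_ ?_ ?_ ?_ ?_ ?_
        (St_of0 _ _ _ ?_) <;> (try unfold Crit) <;> (try unfold StC) <;> omega

lemma step_all (k : ℕ) (hk : 0 < k) (x : ℕ) (h : St k x) : Step k x := by
  rcases h with ⟨w, t, rfl, h⟩ | ⟨h, h3⟩
  · exact step_low k hk w t h
  · have h' : (12 * k + 9) * (6 * k + 4) ≤ x :=
      le_trans (Nat.mul_le_mul_right _ (by omega)) h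
    exact ⟨x + 1, x + 2, x + 3, by omega, by omega, by omega, mem_large _ _ (by omega),
      mem_large _ _ (by omega), mem_large _ _ (by omega), fun g _ => by omega, by omega, by omega,
      by omega, Or.inr ⟨by omega, by omega⟩⟩

lemma inf_GG (k : ℕ) : (setOf (fun x => x ∈ GG k ∧ 0 < x)).Infinite := by
  apply Set.infinite_of_forall_exists_gt
  intro a
  exact ⟨(12 * k + 9) * (6 * k + 4) + a + 1, ⟨mem_large _ _ (by omega), by omega⟩, by omega⟩

lemma posSeq_succ (k i x y : ℕ) (hx : posSeq (GG k) i = x) (hxy : x < y) (hy : y ∈ GG k)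
    (hg : ∀ g ∈ GG k, g ≤ x ∨ y ≤ g) : posSeq (GG k) (i + 1) = y := by
  have hm : StrictMono (posSeq (GG k)) := Nat.nth_strictMono (inf_GG k)
  have h1 : posSeq (GG k) (i + 1) ∈ GG k := (Nat.nth_mem_of_infinite (inf_GG k) (i + 1)).1
  have h2 : posSeq (GG k) i < posSeq (GG k) (i + 1) := hm (Nat.lt_succ_self i)
  obtain ⟨j, hj⟩ : ∃ j, posSeq (GG k) j = y := by
    have : y ∈ Set.range (Nat.nth (fun x => x ∈ GG k ∧ 0 < x)) := by
      rw [Nat.range_nth_of_infinite (inf_GG k)]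
      exact ⟨hy, by omega⟩
    exact this
  have h3 : i < j := hm.lt_iff_lt.1 (by omega)
  have h4 : posSeq (GG k) (i + 1) ≤ posSeq (GG k) j := hm.monotone h3
  have := hg _ h1
  omega

lemma small_elems (k g : ℕ) (hg : g ∈ GG k) : g = 0 ∨ g = 12 * k + 8 ∨ g = 18 * k + 13 ∨
    g = 18 * k + 15 ∨ 18 * k + 15 < g := by
  obtain ⟨x, y, z, rfl⟩ := (mem_GG k g).1 hg
  by_cases h : 2 ≤ x + y + z
  · have : 2 * (12 * k + 8) ≤ (x + y + z) * (12 * k + 8) := Nat.mul_le_mul_right _ h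
    have h1 : y * (12 * k + 8) ≤ y * (18 * k + 13) := Nat.mul_le_mul_left _ (by omega)
    have h2 : z * (12 * k + 8) ≤ z * (18 * k + 15) := Nat.mul_le_mul_left _ (by omega)
    rw [add_mul, add_mul] at this
    omega
  · have : (x = 0 ∧ y = 0 ∧ z = 0) ∨ (x = 1 ∧ y = 0 ∧ z = 0) ∨ (x = 0 ∧ y = 1 ∧ z = 0) ∨
      (x = 0 ∧ y = 0 ∧ z = 1) := by omega
    rcases this with ⟨rfl, rfl, rfl⟩ | ⟨rfl, rfl, rfl⟩ | ⟨rfl, rfl, rfl⟩ | ⟨rfl, rfl, rfl⟩ <;> omega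

lemma gen_mem (k : ℕ) : 12 * k + 8 ∈ GG k ∧ 18 * k + 13 ∈ GG k ∧ 18 * k + 15 ∈ GG k :=
  ⟨AddSubmonoid.subset_closure (by simp), AddSubmonoid.subset_closure (by simp),
    AddSubmonoid.subset_closure (by simp)⟩

lemma posSeq_zero (k : ℕ) : posSeq (GG k) 0 = 12 * k + 8 := by
  have hm : StrictMono (posSeq (GG k)) := Nat.nth_strictMono (inf_GG k)
  have h1 : posSeq (GG k) 0 ∈ GG k ∧ 0 < posSeq (GG k) 0 := Nat.nth_mem_of_infinite (inf_GG k) 0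
  obtain ⟨j, hj⟩ : ∃ j, posSeq (GG k) j = 12 * k + 8 := by
    have : 12 * k + 8 ∈ Set.range (Nat.nth (fun x => x ∈ GG k ∧ 0 < x)) := by
      rw [Nat.range_nth_of_infinite (inf_GG k)]
      exact ⟨(gen_mem k).1, by omega⟩
    exact this
  have h4 : posSeq (GG k) 0 ≤ posSeq (GG k) j := hm.monotone (Nat.zero_le j)
  have := small_elems k _ h1.1
  omega

lemma triple (k : ℕ) (hk : 0 < k) (i x : ℕ) (hx : posSeq (GG k) i = x) (hs : St k x) :
    posSeq (GG k) i % 3 ≠ posSeq (GG k) (i + 1) % 3 ∧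
    posSeq (GG k) i % 3 ≠ posSeq (GG k) (i + 2) % 3 ∧
    posSeq (GG k) (i + 1) % 3 ≠ posSeq (GG k) (i + 2) % 3 ∧ St k (posSeq (GG k) (i + 3)) := by
  obtain ⟨y, z, x', h1, h2, h3, hy, hz, hx', hg, r1, r2, r3, hs'⟩ := step_all k hk x hs
  have e1 := posSeq_succ k i x y hx h1 hy (fun g hh => by have := hg g hh; omega)
  have e2 := posSeq_succ k (i + 1) y z e1 h2 hz (fun g hh => by have := hg g hh; omega)
  have e3 := posSeq_succ k (i + 2) z x' e2 h3 hx' (fun g hh => by have := hg g hh; omega)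
  rw [show i + 3 = i + 2 + 1 from rfl, e3, e1, show i + 2 = i + 1 + 1 from rfl, e2, hx]
  exact ⟨r1, r2, r3, hs'⟩

lemma St_seq (k : ℕ) (hk : 0 < k) (n : ℕ) : St k (posSeq (GG k) (n * 3)) := by
  induction n with
  | zero =>
    rw [zero_mul, posSeq_zero]
    exact Or.inl ⟨2, 0, by ring, by unfold StC; omega⟩
  | succ n ih =>
    have := (triple k hk _ _ rfl ih).2.2.2
    rwa [add_mul]

theorem family16_is_three_permutation (k : ℕ) (hk : 0 < k) :
    IsPermutationSemigroup 3 (AddSubmonoid.closure ({12 * k + 8, 18 * k + 13, 18 * k + 15} : Set ℕ)) := by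
  change IsPermutationSemigroup 3 (GG k)
  refine ⟨?_, ?_, ?_⟩
  · apply (Set.finite_Iio ((12 * k + 9) * (6 * k + 4))).subset
    intro g hg
    by_contra hc
    exact hg (mem_large k g (by simpa using hc))
  · have e0 := posSeq_zero k
    obtain ⟨-, m1, m2⟩ := gen_mem k
    have e1 := posSeq_succ k 0 _ (18 * k + 13) e0 (by omega) m1
      (fun g hh => by have := small_elems k g hh; omega)
    have e2 := posSeq_succ k 1 _ (18 * k + 15) e1 (by omega) m2
      (fun g hh => by have := small_elems k g hh; omega)
    have : posSeq (GG k) '' Set.Iio 3 = {12 * k + 8, 18 * k + 13, 18 * k + 15} := by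
      have h3 : (Set.Iio 3 : Set ℕ) = {0, 1, 2} := by
        ext x; simp only [Set.mem_Iio, Set.mem_insert_iff, Set.mem_singleton_iff]; omega
      rw [h3, Set.image_insert_eq, Set.image_insert_eq, Set.image_singleton, e0]
      rw [show posSeq (GG k) 1 = _ from e1, show posSeq (GG k) 2 = _ from e2]
    rw [this]
  · intro n
    obtain ⟨r1, r2, r3, -⟩ := triple k hk _ _ rfl (St_seq k hk n)
    rw [Fintype.bijective_iff_injective_and_card]
    refine ⟨?_, by simp [ZMod.card]⟩
    intro a b hab
    have hab' := (ZMod.natCast_eq_natCast_iff' _ _ _).1 hab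
    fin_cases a <;> fin_cases b <;> simp at hab' ⊢ <;> omega
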